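/- Let n ≥ 2, let A(s) ∈ F[s]^{n×n} be a regular pencil with homogeneous invariant factors φ₁ | ⋯ | φ_n, and let Ψ(s,t) ∈ F[s,t] be a nonzero homogeneous polynomial of degree n, monic in s. Assume F ∪ {∞} is not contained in Λ(A(s)) ∪ Λ(Ψ(s,t)). Let 0 ≤ r ≤ n. Then there exists a pencil P(s) ∈ F[s]^{n×n} with normal rank exactly r such that the determinant of the homogeneous pencil associated to A(s) + P(s) equals k·Ψ(s,t) for some nonzero k ∈ F, if and only if φ₁(s,t)⋯φ_{n−r}(s,t) divides Ψ(s,t). -/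

import Mathlib

/-- A polynomial matrix is a (matrix) pencil if every entry has degree at most 1. -/
def IsPencil {F : Type*} [Field F] {m n : ℕ} (M : Matrix (Fin m) (Fin n) (Polynomial F)) : Prop :=
  ∀ i j, (M i j).degree ≤ 1

/-- Normal rank of a polynomial matrix: its rank over the field of rational functions. -/
noncomputable def normalRank {F : Type*} [Field F] {m n : ℕ}
    (M : Matrix (Fin m) (Fin n) (Polynomial F)) : ℕ :=
  (M.map (algebraMap (Polynomial F) (RatFunc F))).rank

/-- Strict equivalence of polynomial matrices (pencils):
`G = Q * H * R` for invertible constant matrices `Q`, `R`. -/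
def StrictEquiv {F : Type*} [Field F] {m n : ℕ}
    (G H : Matrix (Fin m) (Fin n) (Polynomial F)) : Prop :=
  ∃ (Q : Matrix (Fin m) (Fin m) F) (R : Matrix (Fin n) (Fin n) F),
    IsUnit Q.det ∧ IsUnit R.det ∧ G = (Q.map Polynomial.C) * H * (R.map Polynomial.C)

/-- The pencil `G₀ + s G₁` as a polynomial matrix. -/
noncomputable def pencilOf {F : Type*} [Field F] {m n : ℕ}
    (G₀ G₁ : Matrix (Fin m) (Fin n) F) : Matrix (Fin m) (Fin n) (Polynomial F) :=
  G₀.map Polynomial.C + (Polynomial.X : Polynomial F) • G₁.map Polynomial.C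

/-- The homogeneous pencil `t G₀ + s G₁` (variables `s = X 0`, `t = X 1`). -/
noncomputable def homPencil {F : Type*} [Field F] {m n : ℕ}
    (G₀ G₁ : Matrix (Fin m) (Fin n) F) : Matrix (Fin m) (Fin n) (MvPolynomial (Fin 2) F) :=
  (MvPolynomial.X 1 : MvPolynomial (Fin 2) F) • G₀.map MvPolynomial.C +
    (MvPolynomial.X 0 : MvPolynomial (Fin 2) F) • G₁.map MvPolynomial.C

/-- The set of `k × k` minors of a matrix. -/
def minorsSet {R : Type*} [CommRing R] {m n : ℕ} (M : Matrix (Fin m) (Fin n) R) (k : ℕ) :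
    Set R :=
  { d | ∃ (ri : Fin k → Fin m) (ci : Fin k → Fin n),
      Function.Injective ri ∧ Function.Injective ci ∧ d = (M.submatrix ri ci).det }

/-- `g` is a greatest common divisor of the set `S`. -/
def IsGCDOf {R : Type*} [CommRing R] (g : R) (S : Set R) : Prop :=
  (∀ x ∈ S, g ∣ x) ∧ ∀ d : R, (∀ x ∈ S, d ∣ x) → d ∣ g

/-- `φ 0, …, φ (n-1)` are homogeneous invariant factors (up to units) of the pencil
`G₀ + s G₁`: for each `k ≤ n` the product of the first `k` of them is a gcd of the
`k × k` minors of the homogeneous pencil `t G₀ + s G₁`. -/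
def IsHomogeneousIF {F : Type*} [Field F] {n : ℕ} (G₀ G₁ : Matrix (Fin n) (Fin n) F)
    (φ : ℕ → MvPolynomial (Fin 2) F) : Prop :=
  ∀ k : ℕ, k ≤ n → IsGCDOf (∏ i ∈ Finset.range k, φ i) (minorsSet (homPencil G₀ G₁) k)

/-- Extension of a finite family of invariant factors (indexed `1, …, n`, stored with
offset `1` so that `φ 0` is the first one) to all integer indices, with the convention
that it is `1` below the range and `0` above it. -/
def extIF {R : Type*} [CommRing R] (n : ℕ) (φ : ℕ → R) : ℤ → R :=
  fun j => if j < 1 then 1 else if (n : ℤ) < j then 0 else φ (j - 1).toNat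

/-- Interlacing condition `φ_{i-r} ∣ ψ_i ∣ φ_{i+r}`, `1 ≤ i ≤ n`. -/
def Interlace {R : Type*} [CommRing R] (n r : ℕ) (φ ψ : ℕ → R) : Prop :=
  ∀ i : ℕ, 1 ≤ i → i ≤ n →
    extIF n φ ((i : ℤ) - r) ∣ extIF n ψ (i : ℤ) ∧
      extIF n ψ (i : ℤ) ∣ extIF n φ ((i : ℤ) + r)

/-- The operation `P_X` on pencils, acting on the pair `(G₀, G₁)` of coefficients of
`G(s) = G₀ + s G₁`: for `X = [[x, y], [z, w]]`,
`P_X(s G₁ + G₀) = s (x G₁ + z G₀) + (y G₁ + w G₀)`. -/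
def mapP {F : Type*} [Field F] {m n : ℕ} (X : Matrix (Fin 2) (Fin 2) F)
    (G : Matrix (Fin m) (Fin n) F × Matrix (Fin m) (Fin n) F) :
    Matrix (Fin m) (Fin n) F × Matrix (Fin m) (Fin n) F :=
  (X 0 1 • G.2 + X 1 1 • G.1, X 0 0 • G.2 + X 1 0 • G.1)

/-- The substitution `Π_X(Φ)(s, t) = Φ(s x + t y, s z + t w)` for `X = [[x, y], [z, w]]`. -/
noncomputable def PiX {F : Type*} [Field F] (X : Matrix (Fin 2) (Fin 2) F)
    (Φ : MvPolynomial (Fin 2) F) : MvPolynomial (Fin 2) F :=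
  MvPolynomial.aeval
    ![MvPolynomial.C (X 0 0) * MvPolynomial.X 0 + MvPolynomial.C (X 0 1) * MvPolynomial.X 1,
      MvPolynomial.C (X 1 0) * MvPolynomial.X 0 + MvPolynomial.C (X 1 1) * MvPolynomial.X 1] Φ

/-- The homogeneous invariant factor of a nonzero `1 × 1` pencil `a(s) = a₀ + s a₁`:
the homogenization `t a₀ + s a₁`, made monic with respect to `s`
(equal to `t` when `a₁ = 0`). -/
noncomputable def homIF1 {F : Type*} [Field F] (a : Polynomial F) : MvPolynomial (Fin 2) F :=
  MvPolynomial.C (a.leadingCoeff)⁻¹ *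
    (MvPolynomial.C (a.coeff 1) * MvPolynomial.X 0 + MvPolynomial.C (a.coeff 0) * MvPolynomial.X 1)

/-- The homogeneous pencil associated to a polynomial matrix pencil. -/
noncomputable def homOf {F : Type*} [Field F] {n : ℕ}
    (M : Matrix (Fin n) (Fin n) (Polynomial F)) : Matrix (Fin n) (Fin n) (MvPolynomial (Fin 2) F) :=
  homPencil (M.map fun p => p.coeff 0) (M.map fun p => p.coeff 1)

/-- Equivalence of square matrices under multiplication by unimodular matrices. -/
def UnimodularEquiv {R ι : Type*} [CommRing R] [Fintype ι] [DecidableEq ι]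
    (M N : Matrix ι ι R) : Prop :=
  ∃ U V : Matrix ι ι R, IsUnit U.det ∧ IsUnit V.det ∧ M = U * N * V

namespace UnimodularEquiv

variable {R ι κ : Type*} [CommRing R] [Fintype ι] [DecidableEq ι] [Fintype κ] [DecidableEq κ]
  {M N K : Matrix ι ι R}

lemma refl (M : Matrix ι ι R) : UnimodularEquiv M M := ⟨1, 1, by simp, by simp, by simp⟩

lemma trans (h : UnimodularEquiv M N) (h' : UnimodularEquiv N K) : UnimodularEquiv M K := by
  obtain ⟨U, V, hU, hV, rfl⟩ := h
  obtain ⟨U', V', hU', hV', rfl⟩ := h'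
  refine ⟨U * U', V' * V, ?_, ?_, by simp only [Matrix.mul_assoc]⟩
  · rw [Matrix.det_mul]; exact hU.mul hU'
  · rw [Matrix.det_mul]; exact hV'.mul hV

lemma mul_left {U : Matrix ι ι R} (hU : IsUnit U.det) (M : Matrix ι ι R) :
    UnimodularEquiv (U * M) M := ⟨U, 1, hU, by simp, by simp⟩

lemma mul_right {V : Matrix ι ι R} (hV : IsUnit V.det) (M : Matrix ι ι R) :
    UnimodularEquiv (M * V) M := ⟨1, V, by simp, hV, by simp⟩

lemma symm (h : UnimodularEquiv M N) : UnimodularEquiv N M := by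
  obtain ⟨U, V, hU, hV, rfl⟩ := h
  refine ⟨U⁻¹, V⁻¹, Matrix.isUnit_nonsing_inv_det _ hU, Matrix.isUnit_nonsing_inv_det _ hV, ?_⟩
  rw [Matrix.mul_assoc U, Matrix.nonsing_inv_mul_cancel_left _ _ hU,
    Matrix.mul_nonsing_inv_cancel_right _ _ hV]

lemma submatrix (h : UnimodularEquiv M N) (e : κ ≃ ι) :
    UnimodularEquiv (M.submatrix e e) (N.submatrix e e) := by
  obtain ⟨U, V, hU, hV, rfl⟩ := h
  refine ⟨U.submatrix e e, V.submatrix e e, by simpa, by simpa, ?_⟩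
  simp [Matrix.submatrix_mul_equiv]

lemma fromBlocks {A B : Matrix κ κ R} (C : Matrix ι ι R) (h : UnimodularEquiv A B) :
    UnimodularEquiv (Matrix.fromBlocks C 0 0 A) (Matrix.fromBlocks C 0 0 B) := by
  obtain ⟨U, V, hU, hV, rfl⟩ := h
  refine ⟨Matrix.fromBlocks 1 0 0 U, Matrix.fromBlocks 1 0 0 V, by simpa, by simpa, ?_⟩
  simp [Matrix.fromBlocks_multiply]

/-- Reindexing rows and columns by different permutations. -/
lemma submatrix_perm (M : Matrix ι ι R) (e f : Equiv.Perm ι) :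
    UnimodularEquiv (M.submatrix e f) M := by
  refine ⟨(1 : Matrix ι ι R).submatrix e id, (1 : Matrix ι ι R).submatrix id f, ?_, ?_, ?_⟩
  · rw [Matrix.det_permute]; simp
    exact e.sign.isUnit.map (Int.castRingHom R)
  · rw [Matrix.det_permute']; simp
    exact f.sign.isUnit.map (Int.castRingHom R)
  · ext i j
    simp [Matrix.mul_apply, Matrix.one_apply]

end UnimodularEquiv

/-- Every nonzero matrix over a Euclidean domain is equivalent to one having an entry
that divides all the entries. -/
lemma exists_unimodularEquiv_entry_dvd {R ι : Type*} [EuclideanDomain R] [Fintype ι]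
    [DecidableEq ι] {M : Matrix ι ι R} (hM : M ≠ 0) :
    ∃ N, UnimodularEquiv M N ∧ ∃ i j, ∀ i' j', N i j ∣ N i' j' := by
  let S : Set R := {a | a ≠ 0 ∧ ∃ N, UnimodularEquiv N M ∧ ∃ i j, N i j = a}
  have hS : S.Nonempty := by
    by_contra h
    apply hM
    ext i j
    by_contra hij
    exact h ⟨M i j, hij, M, .refl M, i, j, rfl⟩
  obtain ⟨a, ⟨ha0, N, hNM, i, j, hij⟩, hmin⟩ :=
    EuclideanDomain.r_wellFounded.has_min S hS
  have hrow : ∀ K, UnimodularEquiv K M → K i j = a → ∀ j', a ∣ K i j' := by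
    intro K hK hKa j'
    by_contra hd
    have hne : j ≠ j' := by rintro rfl; exact hd hKa.symm.dvd
    refine hmin (K i j' % a) ⟨fun h => hd ((EuclideanDomain.mod_eq_zero).mp h),
      K * Matrix.transvection j j' (-(K i j' / a)),
      (UnimodularEquiv.mul_right (by simp [Matrix.det_transvection_of_ne _ _ hne]) K).trans hK,
      i, j', ?_⟩ (EuclideanDomain.mod_lt _ ha0)
    rw [Matrix.mul_transvection_apply_same, hKa, EuclideanDomain.mod_eq_sub_mul_div]
    ring
  have hcol : ∀ K, UnimodularEquiv K M → K i j = a → ∀ i', a ∣ K i' j := by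
    intro K hK hKa i'
    by_contra hd
    have hne : i' ≠ i := by rintro rfl; exact hd hKa.symm.dvd
    refine hmin (K i' j % a) ⟨fun h => hd ((EuclideanDomain.mod_eq_zero).mp h),
      Matrix.transvection i' i (-(K i' j / a)) * K,
      (UnimodularEquiv.mul_left (by simp [Matrix.det_transvection_of_ne _ _ hne]) K).trans hK,
      i', j, ?_⟩ (EuclideanDomain.mod_lt _ ha0)
    rw [Matrix.transvection_mul_apply_same, hKa, EuclideanDomain.mod_eq_sub_mul_div]
    ring
  refine ⟨N, hNM.symm, i, j, fun i' j' => ?_⟩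
  rw [hij]
  by_cases hne : i = i'
  · subst hne; exact hrow N hNM hij j'
  obtain ⟨c, hc⟩ := hcol N hNM hij i'
  have h1 := hrow (Matrix.transvection i i' 1 * (Matrix.transvection i' i (-c) * N))
    ((UnimodularEquiv.mul_left (by simp [Matrix.det_transvection_of_ne _ _ hne]) _).trans
      ((UnimodularEquiv.mul_left
        (by simp [Matrix.det_transvection_of_ne _ _ (Ne.symm hne)]) _).trans hNM))
    (by
      rw [Matrix.transvection_mul_apply_same, Matrix.transvection_mul_apply_of_ne _ _ _ _ hne,
        Matrix.transvection_mul_apply_same, hij, hc]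
      ring) j'
  rw [Matrix.transvection_mul_apply_same, Matrix.transvection_mul_apply_of_ne _ _ _ _ hne,
    Matrix.transvection_mul_apply_same] at h1
  have h2 := hrow N hNM hij j'
  have h3 : N i' j' = (N i j' + 1 * (N i' j' + -c * N i j')) - N i j' + c * N i j' := by ring
  rw [h3]
  exact dvd_add (dvd_sub h1 h2) (h2.mul_left _)

/-- Smith normal form of a square matrix over a Euclidean domain. -/
theorem exists_unimodularEquiv_diagonal {R : Type*} [EuclideanDomain R] :
    ∀ {n : ℕ} (M : Matrix (Fin n) (Fin n) R), ∃ d : Fin n → R,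
      (∀ i j, i ≤ j → d i ∣ d j) ∧ UnimodularEquiv M (Matrix.diagonal d)
  | 0, M => ⟨fun _ => 0, fun i => i.elim0, by
      rw [Subsingleton.elim M (Matrix.diagonal fun _ => 0)]; exact .refl _⟩
  | n + 1, M => by
    by_cases hM : M = 0
    · exact ⟨0, fun _ _ _ => dvd_rfl, by rw [hM]; simpa using UnimodularEquiv.refl _⟩
    obtain ⟨N, hMN, i, j, hij⟩ := exists_unimodularEquiv_entry_dvd hM
    have hMK := hMN.trans (UnimodularEquiv.submatrix_perm N (Equiv.swap 0 i) (Equiv.swap 0 j)).symm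
    generalize hK : N.submatrix (Equiv.swap 0 i) (Equiv.swap 0 j) = K at hMK
    have hK0 : ∀ i' j', K 0 0 ∣ K i' j' := by
      intro i' j'
      rw [← hK]
      simpa using hij _ _
    choose q hq using hK0
    obtain ⟨d, hd, hQ⟩ := exists_unimodularEquiv_diagonal
      (Matrix.of fun i j : Fin n => q i.succ j.succ - q i.succ 0 * q 0 j.succ)
    let e : Fin (n + 1) ≃ Unit ⊕ Fin n :=
      { toFun := Fin.cases (Sum.inl ()) Sum.inr
        invFun := Sum.elim (fun _ => 0) Fin.succ
        left_inv := fun i => by cases i using Fin.cases <;> simp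
        right_inv := fun i => by rcases i with i | i <;> simp }
    obtain ⟨U, V, hU, hV, hUV⟩ := hQ
    have hQ' : UnimodularEquiv
        (Matrix.of fun i j : Fin n => K 0 0 * (q i.succ j.succ - q i.succ 0 * q 0 j.succ))
        (Matrix.diagonal fun i => K 0 0 * d i) := by
      refine ⟨U, V, hU, hV, ?_⟩
      have hs : (Matrix.diagonal fun i => K 0 0 * d i) = K 0 0 • Matrix.diagonal d := by
        rw [← Matrix.diagonal_smul]; rfl
      rw [hs, Matrix.mul_smul, Matrix.smul_mul, ← hUV]
      rfl
    refine ⟨Fin.cases (K 0 0) fun i => K 0 0 * d i, ?_, hMK.trans ?_⟩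
    · intro i j hij
      cases i using Fin.cases with
      | zero => cases j using Fin.cases <;> simp
      | succ i =>
        cases j using Fin.cases with
        | zero => simp at hij
        | succ j => simpa using mul_dvd_mul_left _ (hd i j (by simpa using hij))
    have h := ((UnimodularEquiv.fromBlocks (Matrix.of fun _ _ : Unit => K 0 0) hQ').submatrix e)
    have hdiag : (Matrix.fromBlocks (Matrix.of fun _ _ : Unit => K 0 0) 0 0
        (Matrix.diagonal fun i => K 0 0 * d i)).submatrix e e =
        Matrix.diagonal (Fin.cases (K 0 0) fun i => K 0 0 * d i : Fin (n + 1) → R) := by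
      ext i j
      cases i using Fin.cases <;> cases j using Fin.cases <;>
        simp [e, Matrix.diagonal_apply, (Fin.succ_ne_zero _).symm]
    rw [hdiag] at h
    refine UnimodularEquiv.trans ?_ h
    have hblock : UnimodularEquiv
        (Matrix.fromBlocks (Matrix.of fun _ _ : Unit => K 0 0)
          (Matrix.of fun _ j => K 0 (Fin.succ j)) (Matrix.of fun i _ => K (Fin.succ i) 0)
          (Matrix.of fun i j => K (Fin.succ i) (Fin.succ j)))
        (Matrix.fromBlocks (Matrix.of fun _ _ : Unit => K 0 0) 0 0
          (Matrix.of fun i j : Fin n =>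
            K 0 0 * (q i.succ j.succ - q i.succ 0 * q 0 j.succ))) := by
      refine ⟨Matrix.fromBlocks 1 0 (Matrix.of fun i _ => q (Fin.succ i) 0) 1,
        Matrix.fromBlocks 1 (Matrix.of fun _ j => q 0 (Fin.succ j)) 0 1, by simp, by simp, ?_⟩
      rw [Matrix.fromBlocks_multiply, Matrix.fromBlocks_multiply]
      congr 1
      · ext i j; simp
      · ext i j; simp [Matrix.mul_apply, ← hq]
      · ext i j; simp [Matrix.mul_apply, hq i.succ 0, mul_comm]
      · ext i j; simp [Matrix.mul_apply, hq i.succ j.succ]; ring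
    convert hblock.submatrix e using 1
    ext i j
    cases i using Fin.cases <;> cases j using Fin.cases <;> simp [e]

/-- The companion matrix of a polynomial. -/
noncomputable def companionMatrix {F : Type*} [Field F] (p : Polynomial F) :
    Matrix (Fin p.natDegree) (Fin p.natDegree) F :=
  Matrix.of fun i j => if (j : ℕ) + 1 = p.natDegree then -p.coeff i
    else if (i : ℕ) = j + 1 then 1 else 0

open Polynomial in
lemma companionMatrix_charpoly {F : Type*} [Field F] {p : Polynomial F} (hp : p.Monic) :
    (companionMatrix p).charpoly = p := by
  have hmin : minpoly F (AdjoinRoot.powerBasis' hp).gen = p := by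
    rw [AdjoinRoot.powerBasis'_gen, AdjoinRoot.minpoly_root hp.ne_zero, hp.leadingCoeff]
    simp
  have h := charpoly_leftMulMatrix (AdjoinRoot.powerBasis' hp)
  rw [PowerBasis.leftMulMatrix, PowerBasis.minpolyGen_eq, hmin] at h
  exact h

lemma charpoly_blockDiagonal' {F ι : Type*} [Field F] [Fintype ι] [LinearOrder ι] {m : ι → ℕ}
    (M : ∀ i, Matrix (Fin (m i)) (Fin (m i)) F) :
    (Matrix.blockDiagonal' M).charpoly = ∏ i, (M i).charpoly := by
  simp only [Matrix.charpoly]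
  have htri : (Matrix.blockDiagonal' M).charmatrix.BlockTriangular Sigma.fst := by
    rintro ⟨i, a⟩ ⟨j, b⟩ hij
    rw [Matrix.charmatrix_apply, Matrix.blockDiagonal'_apply, dif_neg hij.ne',
      Matrix.diagonal_apply_ne _ (by rintro h; cases h; exact lt_irrefl _ hij)]
    simp
  rw [htri.det_fintype]
  refine Finset.prod_congr rfl fun i _ => ?_
  rw [← Matrix.det_submatrix_equiv_self (Equiv.sigmaSubtype i).symm]
  congr 1
  refine Matrix.ext fun a b => ?_
  change (Matrix.blockDiagonal' M).charmatrix ⟨i, a⟩ ⟨i, b⟩ = (M i).charmatrix a b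
  simp [Matrix.charmatrix_apply, Matrix.diagonal_apply]

lemma prod_castAdd_dvd_of_injective {R : Type*} [CommRing R] {k r : ℕ} {d : Fin (k + r) → R}
    (hd : ∀ i j, i ≤ j → d i ∣ d j) {f : Fin k → Fin (k + r)} (hf : Function.Injective f) :
    ∏ i, d (Fin.castAdd r i) ∣ ∏ i, d (f i) := by
  classical
  let s : Finset (Fin (k + r)) := Finset.univ.image f
  have hs : s.card = k := by simp [s, Finset.card_image_of_injective _ hf]
  have h1 : ∏ i, d (f i) = ∏ i, d (s.orderEmbOfFin hs i) := by
    rw [← Finset.prod_image (s := Finset.univ) (g := f) (f := d) (hf.injOn)]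
    rw [← Finset.prod_image (s := Finset.univ) (g := s.orderEmbOfFin hs) (f := d)
      ((s.orderEmbOfFin hs).injective.injOn), Finset.image_orderEmbOfFin_univ]
  rw [h1]
  refine Finset.prod_dvd_prod_of_dvd _ _ fun i _ => hd _ _ ?_
  rw [Fin.le_def]
  obtain ⟨i, hi⟩ := i
  induction i with
  | zero => simp
  | succ i ih =>
    have h := (s.orderEmbOfFin hs).strictMono
      (show (⟨i, by omega⟩ : Fin k) < ⟨i + 1, hi⟩ by simp)
    rw [Fin.lt_def] at h
    exact (Nat.succ_le_succ (ih _ (Finset.mem_univ _))).trans h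

lemma prod_dvd_det_submatrix {R : Type*} [CommRing R] {k r : ℕ} {d : Fin (k + r) → R}
    (hd : ∀ i j, i ≤ j → d i ∣ d j) (U V : Matrix (Fin (k + r)) (Fin (k + r)) R)
    (ri ci : Fin k → Fin (k + r)) :
    ∏ i, d (Fin.castAdd r i) ∣ ((U * Matrix.diagonal d * V).submatrix ri ci).det := by
  have h : (U * Matrix.diagonal d * V).submatrix ri ci =
      fun i => ∑ j, U (ri i) j • fun l => d j * V j (ci l) := by
    ext i l
    rw [Matrix.submatrix_apply, Matrix.mul_assoc, Matrix.mul_apply]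
    simp [Matrix.diagonal_mul]
  have hdet := (Matrix.detRowAlternating (n := Fin k) (R := R)).toMultilinearMap.map_sum
    (g := fun i j => U (ri i) j • fun l => d j * V j (ci l))
  rw [← h] at hdet
  refine Dvd.dvd.trans ?_ (dvd_of_eq hdet.symm)
  refine Finset.dvd_sum fun f _ => ?_
  have h2 := (Matrix.detRowAlternating (n := Fin k) (R := R)).toMultilinearMap.map_smul_univ
    (fun i => U (ri i) (f i)) (fun i l => d (f i) * V (f i) (ci l))
  have h3 : Matrix.det (fun i l => d (f i) * V (f i) (ci l)) =
      (∏ i, d (f i)) * (V.submatrix f ci).det := Matrix.det_mul_column _ _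
  refine Dvd.dvd.trans ?_ (dvd_of_eq h2.symm)
  refine Dvd.dvd.mul_left ?_ _
  refine Dvd.dvd.trans ?_ (dvd_of_eq h3.symm)
  by_cases hf : Function.Injective f
  · exact (prod_castAdd_dvd_of_injective hd hf).mul_right _
  · rw [Function.Injective] at hf
    push Not at hf
    obtain ⟨a, b, hab, hne⟩ := hf
    rw [Matrix.det_zero_of_row_eq (M := V.submatrix f ci) hne (by ext; simp [hab])]
    simp

open Polynomial Module in
lemma linearCombination_charmatrix_mulVec {F ι : Type*} [Field F] [Fintype ι] [DecidableEq ι]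
    (T : Matrix ι ι F) (w : ι → F[X]) :
    Fintype.linearCombination F[X]
      (fun i => AEval'.of (Matrix.toLin' T) (Pi.single i (1 : F))) (T.charmatrix.mulVec w) = 0 := by
  suffices h : (Fintype.linearCombination F[X]
      (fun i => AEval'.of (Matrix.toLin' T) (Pi.single i (1 : F)))) ∘ₗ
        T.charmatrix.mulVecLin = 0 by
    exact congrArg (fun f => f w) h
  refine (Pi.basisFun F[X] ι).ext fun j => ?_
  have hT : T.mulVec (Pi.single j 1) = ∑ i, T i j • Pi.single i (1 : F) := by
    ext i
    simp [Finset.sum_apply, Pi.single_apply]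
  simp only [Pi.basisFun_apply, LinearMap.comp_apply, Matrix.mulVecLin_apply,
    Matrix.mulVec_single_one, LinearMap.zero_apply, Fintype.linearCombination_apply,
    Matrix.col_apply, Matrix.charmatrix_apply, sub_smul, Finset.sum_sub_distrib,
    Matrix.diagonal_apply, ite_smul, zero_smul, Finset.sum_ite_eq', Finset.mem_univ, if_true]
  rw [AEval'.X_smul_of, Matrix.toLin'_apply, hT, map_sum, sub_eq_zero]
  refine Finset.sum_congr rfl fun i _ => ?_
  rw [map_smul, ← algebraMap_eq, algebraMap_smul]

open Polynomial Module in
/-- A matrix is similar to the direct sum of the companion matrices of the entries of a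
diagonal form of its characteristic matrix. -/
lemma exists_similar_blockDiagonal'_companionMatrix {F ι : Type*} [Field F] [Fintype ι]
    [DecidableEq ι] (T : Matrix ι ι F) {d : ι → F[X]} (hm : ∀ i, (d i).Monic)
    (hT : UnimodularEquiv T.charmatrix (Matrix.diagonal d)) :
    ∃ (e : ι ≃ Σ i, Fin (d i).natDegree) (S : Matrix ι ι F), IsUnit S.det ∧
      T * S = S * (Matrix.blockDiagonal' fun i => companionMatrix (d i)).submatrix e e := by
  obtain ⟨U, V, hU, hV, hUV⟩ := hT
  have hdeg : ∑ i, (d i).natDegree = Fintype.card ι := by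
    have h : T.charpoly = ∏ i, d i := by
      refine eq_of_monic_of_associated T.charpoly_monic (monic_prod_of_monic _ _ fun i _ => hm i) ?_
      rw [Matrix.charpoly, hUV, Matrix.det_mul, Matrix.det_mul, Matrix.det_diagonal]
      exact (associated_mul_unit_left _ _ hV).trans (associated_unit_mul_left _ _ hU)
    rw [← natDegree_prod_of_monic _ _ fun i _ => hm i, ← h, Matrix.charpoly_natDegree_eq_dim]
  have e : ι ≃ Σ i, Fin (d i).natDegree :=
    Fintype.equivOfCardEq (by simp [hdeg])
  let π := Fintype.linearCombination F[X]
      (fun i => AEval'.of (Matrix.toLin' T) (Pi.single i (1 : F)))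
  let v : ι → AEval' (Matrix.toLin' T) := fun l => π (U.col l)
  have hv : ∀ l, d l • v l = 0 := by
    intro l
    have h := linearCombination_charmatrix_mulVec T (V⁻¹.col l)
    rw [hUV] at h
    rw [← map_smul, ← h]
    congr 1
    rw [← Matrix.mulVec_single_one, ← Matrix.mulVec_single_one, Matrix.mulVec_mulVec,
      Matrix.mul_nonsing_inv_cancel_right _ _ hV, ← Matrix.mulVec_mulVec, ← Matrix.mulVec_smul]
    rw [Matrix.diagonal_mulVec_single, mul_one, ← Pi.single_smul, smul_eq_mul, mul_one]
  have hred : ∀ l (p : F[X]), p • v l =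
      ∑ j : Fin (d l).natDegree, (p %ₘ d l).coeff j • (X ^ (j : ℕ) : F[X]) • v l := by
    intro l p
    conv_lhs => rw [← modByMonic_add_div p (d l), add_smul, mul_comm, mul_smul, hv, smul_zero,
      add_zero]
    by_cases h1 : d l = 1
    · have : v l = 0 := by simpa [h1] using hv l
      simp [this]
    conv_lhs => rw [as_sum_range' (p %ₘ d l) (d l).natDegree (natDegree_modByMonic_lt _ (hm l) h1),
      Finset.sum_smul, Finset.sum_range]
    refine Finset.sum_congr rfl fun j _ => ?_
    rw [← smul_X_eq_monomial, smul_assoc]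
  let S : Matrix ι ι F := fun i a =>
    (AEval'.of (Matrix.toLin' T)).symm ((X ^ ((e a).2 : ℕ) : F[X]) • v (e a).1) i
  have hS : ∀ x : ι → F, AEval'.of (Matrix.toLin' T) (S.mulVec x) =
      ∑ l, ∑ j : Fin (d l).natDegree, x (e.symm ⟨l, j⟩) • (X ^ (j : ℕ) : F[X]) • v l := by
    intro x
    have h : S.mulVec x = ∑ a, x a • (AEval'.of (Matrix.toLin' T)).symm
        ((X ^ ((e a).2 : ℕ) : F[X]) • v (e a).1) := by
      ext i
      simp [S, Matrix.mulVec, dotProduct, mul_comm]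
    rw [h, map_sum, ← Fintype.sum_sigma'
      (fun l (j : Fin (d l).natDegree) => x (e.symm ⟨l, j⟩) • (X ^ (j : ℕ) : F[X]) • v l)]
    refine Fintype.sum_equiv e _ _ fun a => ?_
    rw [map_smul, LinearEquiv.apply_symm_apply, Sigma.eta, Equiv.symm_apply_apply]
  refine ⟨e, S, ?_, ?_⟩
  · rw [← Matrix.isUnit_iff_isUnit_det, ← Matrix.mulVec_surjective_iff_isUnit]
    intro x
    let p := U⁻¹.mulVec (fun i => C (x i))
    let g : (Σ i, Fin (d i).natDegree) → F := fun s => (p s.1 %ₘ d s.1).coeff s.2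
    refine ⟨fun a => g (e a), ?_⟩
    apply (AEval'.of (Matrix.toLin' T)).injective
    rw [hS]
    simp only [Equiv.apply_symm_apply]
    have h : ∀ l, ∑ j : Fin (d l).natDegree, g ⟨l, j⟩ • (X ^ (j : ℕ) : F[X]) • v l =
        p l • v l := fun l => (hred l (p l)).symm
    rw [Finset.sum_congr rfl fun l _ => h l]
    have h1 : ∑ l, p l • v l = π (U.mulVec p) := by
      rw [Matrix.mulVec_eq_sum, map_sum]
      refine Finset.sum_congr rfl fun l _ => ?_
      rw [op_smul_eq_smul, map_smul]
      rfl
    rw [h1, Matrix.mulVec_mulVec, Matrix.mul_nonsing_inv _ hU, Matrix.one_mulVec,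
      Fintype.linearCombination_apply]
    conv_rhs => rw [pi_eq_sum_univ' x, map_sum]
    refine Finset.sum_congr rfl fun i _ => ?_
    rw [map_smul, ← algebraMap_eq, algebraMap_smul]
  · refine Matrix.ext_col fun a => ?_
    obtain ⟨⟨l, j⟩, rfl⟩ := e.symm.surjective a
    rw [← Matrix.mulVec_single_one, ← Matrix.mulVec_single_one, ← Matrix.mulVec_mulVec,
      ← Matrix.mulVec_mulVec]
    apply (AEval'.of (Matrix.toLin' T)).injective
    rw [hS, ← Matrix.toLin'_apply T, ← AEval'.X_smul_of]
    have h1 : AEval'.of (Matrix.toLin' T) (S.mulVec (Pi.single (e.symm ⟨l, j⟩) 1)) =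
        (X ^ (j : ℕ) : F[X]) • v l := by
      rw [Matrix.mulVec_single_one, ← LinearEquiv.eq_symm_apply]
      ext i
      change (AEval'.of (Matrix.toLin' T)).symm ((X ^ ((e (e.symm ⟨l, j⟩)).2 : ℕ) : F[X]) •
        v (e (e.symm ⟨l, j⟩)).1) i = _
      rw [Equiv.apply_symm_apply]
    rw [h1, smul_smul, ← pow_succ', Fintype.sum_eq_single l]
    · simp only [Matrix.mulVec_single_one, Matrix.col_apply, Matrix.submatrix_apply,
        Equiv.apply_symm_apply, Matrix.blockDiagonal'_apply_eq, companionMatrix, Matrix.of_apply]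
      by_cases hj : (j : ℕ) + 1 = (d l).natDegree
      · simp only [hj, if_true]
        have h2 := hv l
        rw [(hm l).as_sum, add_smul, Finset.sum_range, Finset.sum_smul] at h2
        rw [eq_neg_of_add_eq_zero_left h2, ← Finset.sum_neg_distrib]
        refine Finset.sum_congr rfl fun i _ => ?_
        rw [neg_smul, C_mul', smul_assoc]
      · simp only [hj, if_false]
        rw [Fintype.sum_eq_single ⟨j + 1, by omega⟩]
        · simp
        · intro i hi
          rw [if_neg (fun h => hi (Fin.ext h)), zero_smul]
    · intro l' hl
      refine Finset.sum_eq_zero fun i _ => ?_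
      simp [Matrix.blockDiagonal'_apply, hl]

open Polynomial in
/-- Passing from a direct sum of companion matrices to a single companion matrix changes only
the last columns of the blocks. -/
lemma rank_companionMatrix_sub_blockDiagonal'_le {F : Type*} [Field F] {r : ℕ} (d : Fin r → F[X])
    (θ : F[X]) (hθ : ∑ i, (d i).natDegree = θ.natDegree) :
    ∃ h : (Σ i, Fin (d i).natDegree) ≃ Fin θ.natDegree,
      ((companionMatrix θ).submatrix h h -
        Matrix.blockDiagonal' fun i => companionMatrix (d i)).rank ≤ r := by
  let h := finSigmaFinEquiv.trans (finCongr hθ)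
  have hsucc : ∀ i (j : ℕ) (hj : j + 1 < (d i).natDegree),
      (h ⟨i, ⟨j + 1, hj⟩⟩ : ℕ) = h ⟨i, ⟨j, by omega⟩⟩ + 1 := by
    intro i j hj
    simp [h, finSigmaFinEquiv_apply, add_assoc]
  refine ⟨h, ?_⟩
  rw [← Matrix.rank_transpose]
  let s : Finset (Σ i, Fin (d i).natDegree) :=
    Finset.univ.filter fun b => (b.2 : ℕ) + 1 = (d b.1).natDegree
  have hs : s.card ≤ r := by
    conv_rhs => rw [← Fintype.card_fin r, ← Finset.card_univ]
    refine Finset.card_le_card_of_injOn Sigma.fst (fun _ _ => Finset.mem_univ _) ?_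
    rintro ⟨i, a⟩ ha ⟨j, b⟩ hb hij
    obtain rfl : i = j := hij
    simp only [Finset.coe_filter, Finset.mem_univ, true_and, Set.mem_ofPred_eq, s] at ha hb
    rw [Sigma.mk.injEq]
    exact ⟨rfl, heq_of_eq (Fin.ext (by omega))⟩
  refine (Matrix.rank_le_card_of_support_subset _ s ?_).trans hs
  rw [Function.support_subset_iff']
  rintro ⟨i, j, hj⟩ hij
  have hj1 : j + 1 ≠ (d i).natDegree := by simpa [s] using hij
  ext b
  have h1 := hsucc i j (by omega)
  have h2 := (h ⟨i, ⟨j + 1, by omega⟩⟩).isLt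
  have h3 : (h b : ℕ) = h ⟨i, ⟨j, hj⟩⟩ + 1 ↔ b = ⟨i, ⟨j + 1, by omega⟩⟩ := by
    rw [← h1, ← Fin.ext_iff, h.apply_eq_iff_eq]
  simp only [Matrix.row_apply, Matrix.transpose_apply, Matrix.sub_apply, Matrix.submatrix_apply,
    companionMatrix, Matrix.of_apply, Pi.zero_apply]
  rw [if_neg (by omega), sub_eq_zero]
  obtain ⟨i', j'⟩ := b
  rw [Matrix.blockDiagonal'_apply]
  by_cases hi : i' = i
  · subst hi
    simp only [h3, hj1, if_false, dite_true, Matrix.of_apply, cast_eq]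
    simp [Fin.ext_iff]
  · rw [if_neg (by rw [h3]; rintro ⟨⟩; exact hi rfl)]
    simp [hi]

open Polynomial in
lemma exists_rank_le_charpoly_add_eq {F : Type*} [Field F] {k r : ℕ}
    (T : Matrix (Fin k ⊕ Fin r) (Fin k ⊕ Fin r) F) {d : Fin k ⊕ Fin r → F[X]}
    (hm : ∀ i, (d i).Monic) (hT : UnimodularEquiv T.charmatrix (Matrix.diagonal d))
    {ψ : F[X]} (hψ : ψ.Monic) (hdeg : ψ.natDegree = k + r)
    (hdvd : ∏ i, d (Sum.inl i) ∣ ψ) :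
    ∃ Z : Matrix (Fin k ⊕ Fin r) (Fin k ⊕ Fin r) F, Z.rank ≤ r ∧ (T + Z).charpoly = ψ := by
  obtain ⟨e, S, hS, hTS⟩ := exists_similar_blockDiagonal'_companionMatrix T hm hT
  obtain ⟨θ, rfl⟩ := hdvd
  have hq : (∏ i, d (Sum.inl i)).Monic := monic_prod_of_monic _ _ fun i _ => hm _
  have hθ : θ.Monic := hq.of_mul_monic_left hψ
  have hcard : ∑ i, (d (Sum.inr i)).natDegree = θ.natDegree := by
    have h := Fintype.card_congr e
    simp only [Fintype.card_sum, Fintype.card_fin, Fintype.card_sigma, Fintype.sum_sum_type] at h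
    rw [hq.natDegree_mul hθ, natDegree_prod_of_monic _ _ fun i _ => hm _] at hdeg
    omega
  obtain ⟨h, hr⟩ := rank_companionMatrix_sub_blockDiagonal'_le (fun i => d (Sum.inr i)) θ hcard
  let g := e.trans (Equiv.sumSigmaDistrib _)
  set D₁ := Matrix.blockDiagonal' fun i => companionMatrix (d (Sum.inl i))
  set D₂ := Matrix.blockDiagonal' fun i => companionMatrix (d (Sum.inr i))
  have hC : (Matrix.blockDiagonal' fun i => companionMatrix (d i)).submatrix e e =
      (Matrix.fromBlocks D₁ 0 0 D₂).submatrix g g := by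
    have : (Matrix.blockDiagonal' fun i => companionMatrix (d i)) =
        (Matrix.fromBlocks D₁ 0 0 D₂).submatrix (Equiv.sumSigmaDistrib _)
          (Equiv.sumSigmaDistrib _) := by
      ext ⟨i, a⟩ ⟨j, b⟩
      rcases i with i | i <;> rcases j with j | j <;>
        simp [D₁, D₂, Matrix.blockDiagonal'_apply]
    rw [this, Matrix.submatrix_submatrix]
    rfl
  set Y := (companionMatrix θ).submatrix h h
  refine ⟨S * (Matrix.fromBlocks 0 0 0 (Y - D₂)).submatrix g g * S⁻¹, ?_, ?_⟩
  · refine (Matrix.rank_mul_le_left _ _).trans ((Matrix.rank_mul_le_right _ _).trans ?_)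
    rw [Matrix.rank_submatrix]
    have h1 : Matrix.fromBlocks 0 0 0 (Y - D₂) =
        Matrix.fromRows (0 : Matrix (Σ i, Fin (d (Sum.inl i)).natDegree)
          (Σ i, Fin (d (Sum.inr i)).natDegree) F) (Y - D₂) *
          Matrix.fromCols (0 : Matrix (Σ i, Fin (d (Sum.inr i)).natDegree)
            (Σ i, Fin (d (Sum.inl i)).natDegree) F)
            (1 : Matrix (Σ i, Fin (d (Sum.inr i)).natDegree) _ F) := by
      rw [Matrix.mul_fromCols, Matrix.fromRows_mul, Matrix.fromRows_mul]
      ext (i | i) (j | j) <;> simp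
    have h2 : Matrix.fromRows (0 : Matrix (Σ i, Fin (d (Sum.inl i)).natDegree)
          (Σ i, Fin (d (Sum.inr i)).natDegree) F) (Y - D₂) =
        Matrix.fromRows (0 : Matrix (Σ i, Fin (d (Sum.inl i)).natDegree)
          (Σ i, Fin (d (Sum.inr i)).natDegree) F)
          (1 : Matrix (Σ i, Fin (d (Sum.inr i)).natDegree) _ F) * (Y - D₂) := by
      rw [Matrix.fromRows_mul, Matrix.zero_mul, Matrix.one_mul]
    rw [h1, h2]
    exact (Matrix.rank_mul_le_left _ _).trans ((Matrix.rank_mul_le_right _ _).trans hr)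
  · have h1 : T = S * (Matrix.fromBlocks D₁ 0 0 D₂).submatrix g g * S⁻¹ := by
      rw [← hC, ← hTS, Matrix.mul_nonsing_inv_cancel_right _ _ hS]
    have h2 : T + S * (Matrix.fromBlocks 0 0 0 (Y - D₂)).submatrix g g * S⁻¹ =
        S * (Matrix.fromBlocks D₁ 0 0 Y).submatrix g g * S⁻¹ := by
      have h3 : (Matrix.fromBlocks D₁ 0 0 D₂).submatrix g g +
          (Matrix.fromBlocks 0 0 0 (Y - D₂)).submatrix g g =
          (Matrix.fromBlocks D₁ 0 0 D₂ + Matrix.fromBlocks 0 0 0 (Y - D₂)).submatrix g g := rfl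
      conv_lhs => rw [h1]
      rw [← Matrix.add_mul, ← Matrix.mul_add, h3, Matrix.fromBlocks_add]
      simp
    have h3 := Matrix.charpoly_units_conj (Matrix.nonsingInvUnit S hS)
      ((Matrix.fromBlocks D₁ 0 0 Y).submatrix g g)
    have h4 := Matrix.charpoly_reindex g.symm (Matrix.fromBlocks D₁ 0 0 Y)
    have h5 : Y.charpoly = θ :=
      (Matrix.charpoly_reindex h.symm (companionMatrix θ)).trans (companionMatrix_charpoly hθ)
    have h6 : D₁.charpoly = ∏ i, d (Sum.inl i) := by
      rw [charpoly_blockDiagonal']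
      exact Finset.prod_congr rfl fun i _ => companionMatrix_charpoly (hm _)
    rw [h2]
    refine h3.trans (h4.trans ?_)
    rw [Matrix.charpoly_fromBlocks_zero₁₂, h5, h6]

lemma charmatrix_submatrix_equiv {R ι κ : Type*} [CommRing R] [Fintype ι] [DecidableEq ι]
    [Fintype κ] [DecidableEq κ] (T : Matrix ι ι R) (f : κ ≃ ι) :
    (T.submatrix f f).charmatrix = T.charmatrix.submatrix f f := by
  simpa [Matrix.reindex_apply] using Matrix.charmatrix_reindex (M := T) f.symm

open Polynomial in
lemma pencilOf_eq_map_mul_charmatrix {F : Type*} [Field F] {n : ℕ}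
    {A₀ A₁ : Matrix (Fin n) (Fin n) F} (hA : IsUnit A₁.det) :
    pencilOf A₀ A₁ = A₁.map C * (-(A₁⁻¹ * A₀)).charmatrix := by
  have h : A₁ * (A₁⁻¹ * A₀) = A₀ := by
    rw [← Matrix.mul_assoc, Matrix.mul_nonsing_inv _ hA, Matrix.one_mul]
  rw [Matrix.charmatrix, Matrix.mul_sub, RingHom.mapMatrix_apply, ← Matrix.map_mul, Matrix.mul_neg,
    h, pencilOf, Matrix.scalar_apply, ← Matrix.smul_one_eq_diagonal, Matrix.mul_smul,
    Matrix.mul_one, Matrix.map_neg _ (map_neg _), sub_neg_eq_add, add_comm]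

open Polynomial in
lemma exists_monic_unimodularEquiv_charmatrix {F : Type*} [Field F] {n : ℕ}
    (T : Matrix (Fin n) (Fin n) F) :
    ∃ d : Fin n → F[X], (∀ i j, i ≤ j → d i ∣ d j) ∧ (∀ i, (d i).Monic) ∧
      UnimodularEquiv T.charmatrix (Matrix.diagonal d) := by
  obtain ⟨d, hd, hT⟩ := exists_unimodularEquiv_diagonal T.charmatrix
  have h0 : ∀ i, d i ≠ 0 := by
    obtain ⟨U, V, -, -, hUV⟩ := hT
    have h : T.charpoly ≠ 0 := T.charpoly_monic.ne_zero
    rw [Matrix.charpoly, hUV, Matrix.det_mul, Matrix.det_mul, Matrix.det_diagonal] at h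
    exact fun i => Finset.prod_ne_zero_iff.mp
      (right_ne_zero_of_mul (left_ne_zero_of_mul h)) i (Finset.mem_univ i)
  classical
  have hn : ∀ i, normalize (d i) = d i * C (d i).leadingCoeff⁻¹ := fun i => by
    rw [normalize_apply, coe_normUnit_of_ne_zero (h0 i)]
  refine ⟨fun i => normalize (d i), fun i j hij => by simpa using hd i j hij,
    fun i => monic_normalize (h0 i), hT.trans ?_⟩
  refine ⟨1, Matrix.diagonal fun i => C (d i).leadingCoeff, by simp, ?_, ?_⟩
  · rw [Matrix.det_diagonal, ← map_prod]
    exact isUnit_C.mpr (IsUnit.mk0 _ (Finset.prod_ne_zero_iff.mpr fun i _ =>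
      leadingCoeff_ne_zero.mpr (h0 i)))
  · rw [Matrix.one_mul, Matrix.diagonal_mul_diagonal]
    congr 1
    ext1 i
    rw [hn, mul_assoc, ← C_mul, inv_mul_cancel₀ (leadingCoeff_ne_zero.mpr (h0 i)), C_1, mul_one]

open Polynomial in
/-- Determinant assignment for `A₀ + s A₁` with `A₁` invertible by constant perturbations of
bounded rank. -/
lemma exists_monic_dvd_minors_and_rank_le_det_pencilOf_eq {F : Type*} [Field F] {k r : ℕ}
    (A₀ A₁ : Matrix (Fin (k + r)) (Fin (k + r)) F) (hA : IsUnit A₁.det) :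
    ∃ q : F[X], q.Monic ∧
      (∀ ri ci : Fin k → Fin (k + r), q ∣ ((pencilOf A₀ A₁).submatrix ri ci).det) ∧
      ∀ ψ : F[X], ψ.Monic → ψ.natDegree = k + r → q ∣ ψ →
        ∃ Z : Matrix (Fin (k + r)) (Fin (k + r)) F, Z.rank ≤ r ∧
          (pencilOf (A₀ + Z) A₁).det = C A₁.det * ψ := by
  obtain ⟨d, hd, hm, hT⟩ := exists_monic_unimodularEquiv_charmatrix (-(A₁⁻¹ * A₀))
  refine ⟨∏ i, d (Fin.castAdd r i), monic_prod_of_monic _ _ fun i _ => hm _, ?_, ?_⟩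
  · intro ri ci
    obtain ⟨U, V, -, -, hUV⟩ := hT
    rw [pencilOf_eq_map_mul_charmatrix hA, hUV, Matrix.mul_assoc U, ← Matrix.mul_assoc,
      ← Matrix.mul_assoc]
    exact prod_dvd_det_submatrix hd _ _ ri ci
  · intro ψ hψ hdeg hdvd
    obtain ⟨f, hf⟩ : ∃ f : Fin k ⊕ Fin r ≃ Fin (k + r), f = finSumFinEquiv := ⟨_, rfl⟩
    have hT' : UnimodularEquiv ((-(A₁⁻¹ * A₀)).submatrix f f).charmatrix
        (Matrix.diagonal (d ∘ f)) := by
      have h := hT.submatrix f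
      rw [Matrix.submatrix_diagonal_equiv] at h
      rwa [← charmatrix_submatrix_equiv] at h
    obtain ⟨Z, hZ, hZψ⟩ := exists_rank_le_charpoly_add_eq _ (fun i => hm (f i)) hT' hψ hdeg
      (by simpa [hf] using hdvd)
    refine ⟨-A₁ * Z.submatrix f.symm f.symm, ?_, ?_⟩
    · refine (Matrix.rank_mul_le_right _ _).trans ?_
      rwa [Matrix.rank_submatrix]
    · have h : -(A₁⁻¹ * (A₀ + -A₁ * Z.submatrix f.symm f.symm)) =
          Matrix.reindex f f ((-(A₁⁻¹ * A₀)).submatrix f f + Z) := by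
        rw [Matrix.mul_add, Matrix.neg_mul, Matrix.mul_neg, neg_add, neg_neg,
          ← Matrix.mul_assoc, Matrix.nonsing_inv_mul _ hA, Matrix.one_mul]
        ext i j
        simp
      rw [pencilOf_eq_map_mul_charmatrix hA, Matrix.det_mul, h, ← Matrix.charpoly,
        Matrix.charpoly_reindex, hZψ, ← RingHom.mapMatrix_apply, ← RingHom.map_det]

lemma isHomogeneous_det {σ R ι : Type*} [CommRing R] [Fintype ι] [DecidableEq ι]
    {M : Matrix ι ι (MvPolynomial σ R)} (hM : ∀ i j, (M i j).IsHomogeneous 1) :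
    M.det.IsHomogeneous (Fintype.card ι) := by
  rw [Matrix.det_apply]
  refine MvPolynomial.IsHomogeneous.sum _ _ _ fun τ _ => ?_
  rw [Units.smul_def, ← Int.cast_smul_eq_zsmul R, MvPolynomial.smul_eq_C_mul]
  refine MvPolynomial.IsHomogeneous.C_mul ?_ _
  simpa using MvPolynomial.IsHomogeneous.prod Finset.univ (fun i => M (τ i) i) (fun _ => 1)
    fun i _ => hM _ _

lemma isHomogeneous_homPencil {F : Type*} [Field F] {m n : ℕ} (A₀ A₁ : Matrix (Fin m) (Fin n) F)
    (i : Fin m) (j : Fin n) : (homPencil A₀ A₁ i j).IsHomogeneous 1 := by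
  simp only [homPencil, Matrix.add_apply, Matrix.smul_apply, Matrix.map_apply, smul_eq_mul]
  refine MvPolynomial.IsHomogeneous.add ?_ ?_ <;>
    exact (MvPolynomial.isHomogeneous_X _ _).mul (MvPolynomial.isHomogeneous_C _ _)

lemma isHomogeneous_det_homPencil {F : Type*} [Field F] {n : ℕ} (A₀ A₁ : Matrix (Fin n) (Fin n) F) :
    (homPencil A₀ A₁).det.IsHomogeneous n := by
  simpa using isHomogeneous_det (isHomogeneous_homPencil A₀ A₁)

lemma isHomogeneous_det_submatrix_homPencil {F : Type*} [Field F] {k m n : ℕ}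
    (A₀ A₁ : Matrix (Fin m) (Fin n) F) (ri : Fin k → Fin m) (ci : Fin k → Fin n) :
    ((homPencil A₀ A₁).submatrix ri ci).det.IsHomogeneous k := by
  simpa using isHomogeneous_det (M := (homPencil A₀ A₁).submatrix ri ci)
    fun i j => isHomogeneous_homPencil A₀ A₁ (ri i) (ci j)

open Polynomial in
lemma map_homPencil_aeval_X_one {F : Type*} [Field F] {m n : ℕ} (A₀ A₁ : Matrix (Fin m) (Fin n) F) :
    (homPencil A₀ A₁).map (MvPolynomial.aeval ![X, (1 : F[X])]) = pencilOf A₀ A₁ := by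
  ext1 i j
  simp [homPencil, pencilOf, algebraMap_eq]

open Polynomial in
lemma aeval_X_one_det_submatrix_homPencil {F : Type*} [Field F] {k m n : ℕ}
    (A₀ A₁ : Matrix (Fin m) (Fin n) F) (ri : Fin k → Fin m) (ci : Fin k → Fin n) :
    MvPolynomial.aeval ![X, (1 : F[X])] ((homPencil A₀ A₁).submatrix ri ci).det =
      ((pencilOf A₀ A₁).submatrix ri ci).det := by
  rw [AlgHom.map_det, AlgHom.mapMatrix_apply, ← Matrix.submatrix_map, map_homPencil_aeval_X_one]

open Polynomial in
lemma aeval_X_one_det_homPencil {F : Type*} [Field F] {n : ℕ} (A₀ A₁ : Matrix (Fin n) (Fin n) F) :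
    MvPolynomial.aeval ![X, (1 : F[X])] (homPencil A₀ A₁).det = (pencilOf A₀ A₁).det :=
  aeval_X_one_det_submatrix_homPencil A₀ A₁ id id

open Polynomial in
lemma natDegree_aeval_X_one_le {R : Type*} [CommSemiring R] {M : MvPolynomial (Fin 2) R} {n : ℕ}
    (hM : M.IsHomogeneous n) : (MvPolynomial.aeval ![X, (1 : R[X])] M).natDegree ≤ n := by
  rw [← mul_one n]
  refine MvPolynomial.aeval_natDegree_le M hM.totalDegree_le _ fun i => ?_
  fin_cases i
  · exact natDegree_X_le
  · simp

open Polynomial in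
lemma homogenize_dvd_of_dvd_aeval {F : Type*} [Field F] {M : MvPolynomial (Fin 2) F} {n : ℕ}
    (hM : M.IsHomogeneous n) {q : F[X]} (hq : q ∣ MvPolynomial.aeval ![X, (1 : F[X])] M) :
    q.homogenize q.natDegree ∣ M := by
  obtain ⟨p, hp⟩ := hq
  have h := natDegree_aeval_X_one_le hM
  rw [← homogenize_eq_of_isHomogeneous hM hp]
  by_cases h0 : q * p = 0
  · simp [h0]
  rw [hp, natDegree_mul (left_ne_zero_of_mul h0) (right_ne_zero_of_mul h0)] at h
  obtain ⟨m, rfl⟩ := Nat.exists_eq_add_of_le ((Nat.le_add_right _ _).trans h)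
  rw [homogenize_mul _ _ le_rfl (by omega)]
  exact dvd_mul_right _ _

open Polynomial in
lemma eval_one_zero_homogenize {R : Type*} [CommSemiring R] (p : R[X]) (n : ℕ) :
    MvPolynomial.eval ![1, 0] (p.homogenize n) = p.coeff n := by
  rw [homogenize, map_sum, Finset.sum_eq_single (n, 0)]
  · rw [MvPolynomial.eval_monomial, Finsupp.prod_fintype _ _ (by simp)]
    simp
  · rintro ⟨a, b⟩ hab hne
    rw [Finset.HasAntidiagonal.mem_antidiagonal] at hab
    have hb : b ≠ 0 := by
      rintro rfl
      exact hne (Prod.ext hab rfl)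
    rw [MvPolynomial.eval_monomial, Finsupp.prod_fintype _ _ (by simp)]
    simp [hb]
  · simp

open Polynomial in
lemma exists_rank_le_det_homPencil_eq {F : Type*} [Field F] {k r : ℕ}
    {A₀ A₁ : Matrix (Fin (k + r)) (Fin (k + r)) F} (hA : IsUnit A₁.det)
    {Ψ : MvPolynomial (Fin 2) F} (hΨ : Ψ.IsHomogeneous (k + r))
    (hΨ0 : MvPolynomial.eval ![1, 0] Ψ ≠ 0)
    (hdvd : ∀ d, (∀ x ∈ minorsSet (homPencil A₀ A₁) k, d ∣ x) → d ∣ Ψ) :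
    ∃ Z : Matrix (Fin (k + r)) (Fin (k + r)) F, Z.rank ≤ r ∧
      ∃ c : F, c ≠ 0 ∧ (homPencil (A₀ + Z) A₁).det = MvPolynomial.C c * Ψ := by
  obtain ⟨q, -, hqd, hq⟩ := exists_monic_dvd_minors_and_rank_le_det_pencilOf_eq A₀ A₁ hA
  have hqΨ := hdvd (q.homogenize q.natDegree) (by
    rintro x ⟨ri, ci, -, -, rfl⟩
    refine homogenize_dvd_of_dvd_aeval (isHomogeneous_det_submatrix_homPencil A₀ A₁ ri ci) ?_
    rw [aeval_X_one_det_submatrix_homPencil]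
    exact hqd ri ci)
  generalize hψ : MvPolynomial.aeval ![X, (1 : F[X])] Ψ = ψ
  have hΨψ := homogenize_eq_of_isHomogeneous hΨ hψ
  have hqψ : q ∣ ψ := by
    have h := map_dvd (MvPolynomial.aeval ![X, (1 : F[X])]) hqΨ
    rwa [aeval_homogenize_X_one _ le_rfl, hψ] at h
  have hdeg : ψ.natDegree ≤ k + r := hψ ▸ natDegree_aeval_X_one_le hΨ
  rw [← hΨψ, eval_one_zero_homogenize] at hΨ0
  have hdeg' : ψ.natDegree = k + r := natDegree_eq_of_le_of_coeff_ne_zero hdeg hΨ0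
  have hlc : ψ.leadingCoeff ≠ 0 := by rwa [leadingCoeff, hdeg']
  obtain ⟨Z, hZ, hdet⟩ := hq (C ψ.leadingCoeff⁻¹ * ψ)
    (monic_C_mul_of_mul_leadingCoeff_eq_one (inv_mul_cancel₀ hlc))
    (by rw [natDegree_C_mul (inv_ne_zero hlc), hdeg']) (hqψ.mul_left _)
  refine ⟨Z, hZ, A₁.det * ψ.leadingCoeff⁻¹, mul_ne_zero hA.ne_zero (inv_ne_zero hlc), ?_⟩
  rw [← mul_assoc, ← C_mul, ← aeval_X_one_det_homPencil] at hdet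
  rw [← homogenize_eq_of_isHomogeneous (isHomogeneous_det_homPencil _ _) hdet, homogenize_C_mul,
    hΨψ]

lemma rank_map_ringHom_le {F K : Type*} [Field F] [Field K] {ι : Type*} [Fintype ι] [DecidableEq ι]
    (f : F →+* K) (M : Matrix ι ι F) : (M.map f).rank ≤ M.rank := by
  obtain ⟨V, U, e, hV, hU, h⟩ := M.exists_rank_normal_form
  have h1 := congrArg f.mapMatrix h
  rw [map_mul, map_mul] at h1
  rw [← RingHom.mapMatrix_apply, ← Matrix.rank_mul_eq_right_of_isUnit_det _ _
    ((Matrix.isUnit_iff_isUnit_det _).mp (hV.map f.mapMatrix)),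
    ← Matrix.rank_mul_eq_left_of_isUnit_det _ _
    ((Matrix.isUnit_iff_isUnit_det _).mp (hU.map f.mapMatrix)), h1, RingHom.mapMatrix_apply,
    ← Matrix.submatrix_map, Matrix.rank_submatrix, Matrix.fromBlocks_map,
    Matrix.map_one _ (map_zero f) (map_one f), Matrix.map_zero _ (map_zero f),
    Matrix.map_zero _ (map_zero f), Matrix.map_zero _ (map_zero f)]
  refine (Matrix.rank_le_card_of_support_subset _ (Finset.univ.map Function.Embedding.inl)
    ?_).trans (by simp)
  rw [Function.support_subset_iff']
  rintro (i | i) hi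
  · simp at hi
  · ext (j | j) <;> simp

open Polynomial in
lemma normalRank_smul_map_C_le {F : Type*} [Field F] {n : ℕ} (p : F[X])
    (Z : Matrix (Fin n) (Fin n) F) : normalRank (p • Z.map C) ≤ Z.rank := by
  have h : (p • Z.map C).map (algebraMap F[X] (RatFunc F)) =
      Matrix.diagonal (fun _ => algebraMap F[X] (RatFunc F) p) *
        Z.map ((algebraMap F[X] (RatFunc F)).comp C) := by
    ext1 i j
    simp
  rw [normalRank, h]
  exact (Matrix.rank_mul_le_right _ _).trans (rank_map_ringHom_le _ _)

lemma map_homPencil {F : Type*} [Field F] {m n : ℕ} (A₀ A₁ : Matrix (Fin m) (Fin n) F)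
    (f : MvPolynomial (Fin 2) F →ₐ[F] MvPolynomial (Fin 2) F) :
    (homPencil A₀ A₁).map f = f (MvPolynomial.X 1) • A₀.map MvPolynomial.C +
      f (MvPolynomial.X 0) • A₁.map MvPolynomial.C := by
  ext1 i j
  simp only [homPencil, ← MvPolynomial.algebraMap_eq, Matrix.map_apply, Matrix.add_apply,
    Matrix.smul_apply, smul_eq_mul, map_add, map_mul, AlgHom.commutes]

open MvPolynomial in
lemma exists_normalRank_le_det_homPencil_eq {F : Type*} [Field F] {k r : ℕ}
    {A₀ A₁ : Matrix (Fin (k + r)) (Fin (k + r)) F} {Ψ : MvPolynomial (Fin 2) F}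
    (hΨ : Ψ.IsHomogeneous (k + r))
    (hc : (∃ c : F, IsUnit (A₀ + c • A₁).det ∧ MvPolynomial.eval ![c, 1] Ψ ≠ 0) ∨
      (IsUnit A₁.det ∧ MvPolynomial.eval ![1, 0] Ψ ≠ 0))
    (hdvd : ∀ d, (∀ x ∈ minorsSet (homPencil A₀ A₁) k, d ∣ x) → d ∣ Ψ) :
    ∃ P₀ P₁ : Matrix (Fin (k + r)) (Fin (k + r)) F, normalRank (pencilOf P₀ P₁) ≤ r ∧
      ∃ c : F, c ≠ 0 ∧ (homPencil (A₀ + P₀) (A₁ + P₁)).det = MvPolynomial.C c * Ψ := by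
  obtain ⟨c, hA, hΨ0⟩ | ⟨hA, hΨ0⟩ := hc
  · let σ : MvPolynomial (Fin 2) F →ₐ[F] MvPolynomial (Fin 2) F :=
      aeval ![C c * X 0 + X 1, X 0]
    let τ : MvPolynomial (Fin 2) F →ₐ[F] MvPolynomial (Fin 2) F :=
      aeval ![X 1, X 0 - C c * X 1]
    have hστ : ∀ p, σ (τ p) = p := fun p => by
      suffices h : σ.comp τ = AlgHom.id F _ from congrArg (· p) h
      refine algHom_ext fun i => ?_
      fin_cases i <;> simp [σ, τ, ← algebraMap_eq]
    have hτσ : ∀ p, τ (σ p) = p := fun p => by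
      suffices h : τ.comp σ = AlgHom.id F _ from congrArg (· p) h
      refine algHom_ext fun i => ?_
      fin_cases i <;> simp [σ, τ, ← algebraMap_eq]
    have hσA : (homPencil A₀ A₁).map σ = homPencil A₁ (A₀ + c • A₁) := by
      rw [map_homPencil]
      ext1 i j
      simp [σ, homPencil]
      ring
    have hτA : (homPencil A₁ (A₀ + c • A₁)).map τ = homPencil A₀ A₁ := by
      rw [← hσA, Matrix.map_map]
      ext1 i j
      simp [hτσ]
    have hσΨ : (σ Ψ).IsHomogeneous (k + r) := by
      rw [← one_mul (k + r)]
      refine hΨ.aeval _ fun i => ?_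
      fin_cases i
      · exact ((isHomogeneous_X _ _).C_mul c).add (isHomogeneous_X _ _)
      · exact isHomogeneous_X _ _
    have hσΨ0 : eval ![1, 0] (σ Ψ) ≠ 0 := by
      convert hΨ0 using 1
      have h : ((aeval ![(1 : F), 0]).comp σ) = aeval ![c, 1] := by
        refine algHom_ext fun i => ?_
        fin_cases i <;> simp [σ]
      simpa [aeval_eq_eval] using congrArg (· Ψ) h
    obtain ⟨Z, hZ, a, ha, hdet⟩ := exists_rank_le_det_homPencil_eq hA hσΨ hσΨ0 (by
      intro d hd
      rw [← hστ d]
      refine map_dvd σ (hdvd _ ?_)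
      rintro x ⟨ri, ci, hri, hci, rfl⟩
      rw [← hτA, Matrix.submatrix_map, ← AlgHom.mapMatrix_apply, ← AlgHom.map_det]
      exact map_dvd τ (hd _ ⟨ri, ci, hri, hci, rfl⟩))
    refine ⟨-c • Z, Z, ?_, a, ha, ?_⟩
    · have h : pencilOf (-c • Z) Z =
          (Polynomial.X - Polynomial.C c : Polynomial F) • Z.map Polynomial.C := by
        ext1 i j
        simp [pencilOf]
        ring
      rw [h]
      exact (normalRank_smul_map_C_le _ _).trans hZ
    · have h := congrArg τ hdet
      rw [AlgHom.map_det, AlgHom.mapMatrix_apply, map_homPencil, map_mul, hτσ,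
        ← algebraMap_eq, AlgHom.commutes] at h
      rw [← algebraMap_eq, ← h]
      congr 1
      ext1 i j
      simp [τ, homPencil]
      ring
  · obtain ⟨Z, hZ, a, ha, hdet⟩ := exists_rank_le_det_homPencil_eq hA hΨ hΨ0 hdvd
    refine ⟨Z, 0, ?_, a, ha, by rwa [add_zero]⟩
    have h : pencilOf Z 0 = (1 : Polynomial F) • Z.map Polynomial.C := by
      ext1 i j
      simp [pencilOf]
    rw [h]
    exact (normalRank_smul_map_C_le _ _).trans hZ

lemma rank_matrix_add_le {K m n : Type*} [Field K] [Fintype m] [Fintype n] (A B : Matrix m n K) :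
    (A + B).rank ≤ A.rank + B.rank := by
  unfold Matrix.rank
  rw [Matrix.mulVecLin_add]
  refine (Submodule.finrank_mono ?_).trans (Submodule.finrank_add_le_finrank_add_finrank _ _)
  rintro _ ⟨v, rfl⟩
  exact Submodule.add_mem_sup ⟨v, rfl⟩ ⟨v, rfl⟩

lemma rank_add_vecMulVec_of_notMem {K ι : Type*} [Field K] [Fintype ι] [DecidableEq ι]
    {P : Matrix ι ι K} {a b x y : ι → K} (hx : P.mulVec x = 0) (hbx : b ⬝ᵥ x ≠ 0)
    (hy : Matrix.vecMul y P = 0) (hya : y ⬝ᵥ a ≠ 0) :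
    (P + Matrix.vecMulVec a b).rank = P.rank + 1 := by
  have hker : LinearMap.ker (P + Matrix.vecMulVec a b).mulVecLin < LinearMap.ker P.mulVecLin := by
    have h : ∀ v, (P + Matrix.vecMulVec a b).mulVec v = P.mulVec v + (b ⬝ᵥ v) • a := fun v => by
      rw [Matrix.add_mulVec, Matrix.vecMulVec_mulVec, op_smul_eq_smul]
    refine SetLike.lt_iff_le_and_exists.mpr ⟨fun v hv => ?_, x, hx, fun hx' => ?_⟩
    · rw [LinearMap.mem_ker, Matrix.mulVecLin_apply, h] at hv
      have h1 := congrArg (y ⬝ᵥ ·) hv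
      simp only [dotProduct_add, Matrix.dotProduct_mulVec, hy, zero_dotProduct, dotProduct_smul,
        zero_add, dotProduct_zero, smul_eq_mul, mul_eq_zero, hya, or_false] at h1
      rw [LinearMap.mem_ker, Matrix.mulVecLin_apply]
      simpa [h1] using hv
    · rw [LinearMap.mem_ker, Matrix.mulVecLin_apply, h, hx, zero_add, smul_eq_zero] at hx'
      rcases hx' with h0 | rfl
      · exact hbx h0
      · simp at hya
  have h1 := Submodule.finrank_lt_finrank_of_lt hker
  have h2 := LinearMap.finrank_range_add_finrank_ker P.mulVecLin
  have h3 := LinearMap.finrank_range_add_finrank_ker (P + Matrix.vecMulVec a b).mulVecLin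
  have h4 := rank_matrix_add_le P (Matrix.vecMulVec a b)
  have h5 := Matrix.rank_vecMulVec_le a b
  unfold Matrix.rank at *
  omega

lemma exists_dotProduct_eq_zero_of_ne_zero {F K ι : Type*} [Field F] [Field K] [Fintype ι]
    [DecidableEq ι] [Nontrivial ι] (f : F →+* K) {x z : ι → K} (hx : x ≠ 0) (hz : z ≠ 0) :
    ∃ u w : ι → F, w ⬝ᵥ u = 0 ∧ (f ∘ w) ⬝ᵥ x ≠ 0 ∧ z ⬝ᵥ (f ∘ u) ≠ 0 := by
  obtain ⟨i, hi⟩ := Function.ne_iff.mp hx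
  obtain ⟨j, hj⟩ := Function.ne_iff.mp hz
  have hs : ∀ i : ι, f ∘ Pi.single i (1 : F) = Pi.single i 1 := fun i => by
    ext j
    simp [Pi.single_apply, apply_ite f]
  by_cases h : ∃ i j, i ≠ j ∧ x i ≠ 0 ∧ z j ≠ 0
  · obtain ⟨i, j, hij, hi, hj⟩ := h
    exact ⟨Pi.single j 1, Pi.single i 1, by simp [hij], by simpa [hs], by simpa [hs]⟩
  · push Not at h
    obtain rfl : i = j := by
      by_contra hij
      exact hj (h i j hij hi)
    obtain ⟨m, hm⟩ := exists_ne i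
    have hzm : z m = 0 := h i m hm.symm hi
    have hxm : x m = 0 := by
      by_contra h0
      exact hj (h m i hm h0)
    refine ⟨Pi.single i 1 - Pi.single m 1, Pi.single i 1 + Pi.single m 1, ?_, ?_, ?_⟩
    · simp [hm, hm.symm]
    · have : f ∘ (Pi.single i 1 + Pi.single m 1 : ι → F) = Pi.single i 1 + Pi.single m 1 := by
        rw [← hs, ← hs]; ext; simp
      simpa [this, hxm]
    · have : f ∘ (Pi.single i 1 - Pi.single m 1 : ι → F) = Pi.single i 1 - Pi.single m 1 := by
        rw [← hs, ← hs]; ext; simp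
      simpa [this, hzm]

lemma pencilOf_add {F : Type*} [Field F] {m n : ℕ} (A₀ A₁ B₀ B₁ : Matrix (Fin m) (Fin n) F) :
    pencilOf (A₀ + B₀) (A₁ + B₁) = pencilOf A₀ A₁ + pencilOf B₀ B₁ := by
  ext1 i j
  simp [pencilOf]
  ring

lemma pencilOf_mul {F : Type*} [Field F] {l m n : ℕ} (A₀ A₁ : Matrix (Fin l) (Fin m) F)
    (N : Matrix (Fin m) (Fin n) F) :
    pencilOf (A₀ * N) (A₁ * N) = pencilOf A₀ A₁ * N.map Polynomial.C := by
  simp only [pencilOf, Matrix.map_mul, Matrix.add_mul, Matrix.smul_mul]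

lemma homPencil_mul {F : Type*} [Field F] {l m n : ℕ} (A₀ A₁ : Matrix (Fin l) (Fin m) F)
    (N : Matrix (Fin m) (Fin n) F) :
    homPencil (A₀ * N) (A₁ * N) =
      homPencil A₀ A₁ * N.map (MvPolynomial.C : F →+* MvPolynomial (Fin 2) F) := by
  simp only [homPencil, Matrix.map_mul, Matrix.add_mul, Matrix.smul_mul]

/-- The normal rank of a perturbation can be raised by one without changing the determinant of
the perturbed pencil. -/
lemma exists_normalRank_add_mul_eq_succ {F : Type*} [Field F] {n : ℕ} (hn : 2 ≤ n)
    {B₀ B₁ P₀ P₁ : Matrix (Fin n) (Fin n) F} (hB : (pencilOf B₀ B₁).det ≠ 0)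
    (hP : normalRank (pencilOf P₀ P₁) < n) :
    ∃ N : Matrix (Fin n) (Fin n) F, (1 + N).det = 1 ∧
      normalRank (pencilOf (P₀ + B₀ * N) (P₁ + B₁ * N)) = normalRank (pencilOf P₀ P₁) + 1 := by
  have : Nontrivial (Fin n) := Fin.nontrivial_iff_two_le.mpr hn
  let a := algebraMap (Polynomial F) (RatFunc F)
  let P := (pencilOf P₀ P₁).map a
  let B := (pencilOf B₀ B₁).map a
  have hdet : P.det = 0 := by
    by_contra h
    have h1 : P.rank = _ := Matrix.rank_of_det_ne_zero h
    rw [Fintype.card_fin] at h1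
    exact hP.ne h1
  have hBdet : B.det ≠ 0 := by
    have h : B.det = a (pencilOf B₀ B₁).det := (RingHom.map_det a _).symm
    rw [h]
    exact (map_ne_zero_iff a (IsFractionRing.injective _ _)).mpr hB
  obtain ⟨x, hx0, hx⟩ := Matrix.exists_mulVec_eq_zero_iff.mpr hdet
  obtain ⟨y, hy0, hy⟩ := Matrix.exists_vecMul_eq_zero_iff.mpr hdet
  have hz0 : Matrix.vecMul y B ≠ 0 := fun h =>
    hBdet (Matrix.exists_vecMul_eq_zero_iff.mp ⟨y, hy0, h⟩)
  obtain ⟨u, w, hwu, hwx, hzu⟩ :=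
    exists_dotProduct_eq_zero_of_ne_zero (a.comp Polynomial.C) hx0 hz0
  refine ⟨Matrix.vecMulVec u w, ?_, ?_⟩
  · rw [Matrix.vecMulVec_eq Unit, Matrix.det_one_add_replicateCol_mul_replicateRow, hwu, add_zero]
  · have h : (pencilOf (P₀ + B₀ * Matrix.vecMulVec u w) (P₁ + B₁ * Matrix.vecMulVec u w)).map a =
        P + Matrix.vecMulVec (B.mulVec (a.comp Polynomial.C ∘ u)) (a.comp Polynomial.C ∘ w) := by
      rw [pencilOf_add, pencilOf_mul, ← Matrix.mul_vecMulVec, Matrix.map_add _ (map_add a),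
        Matrix.map_mul]
      congr 2
      ext1 i j
      simp [Matrix.vecMulVec_apply]
    rw [normalRank, h]
    exact rank_add_vecMulVec_of_notMem hx hwx hy (by rwa [Matrix.dotProduct_mulVec])

lemma exists_normalRank_eq_det_homPencil_eq {F : Type*} [Field F] {n r : ℕ} (hn : 2 ≤ n)
    (hr : r ≤ n) {A₀ A₁ P₀ P₁ : Matrix (Fin n) (Fin n) F}
    (hA : (homPencil (A₀ + P₀) (A₁ + P₁)).det ≠ 0) (hP : normalRank (pencilOf P₀ P₁) ≤ r) :
    ∃ Q₀ Q₁ : Matrix (Fin n) (Fin n) F, normalRank (pencilOf Q₀ Q₁) = r ∧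
      (homPencil (A₀ + Q₀) (A₁ + Q₁)).det = (homPencil (A₀ + P₀) (A₁ + P₁)).det := by
  induction r, hP using Nat.le_induction with
  | base => exact ⟨P₀, P₁, rfl, rfl⟩
  | succ m hm ih =>
    obtain ⟨Q₀, Q₁, hQ, hdet⟩ := ih (by omega)
    have hB : (pencilOf (A₀ + Q₀) (A₁ + Q₁)).det ≠ 0 := by
      intro h0
      rw [← aeval_X_one_det_homPencil] at h0
      have h := Polynomial.homogenize_eq_of_isHomogeneous (isHomogeneous_det_homPencil _ _) h0
      rw [Polynomial.homogenize_zero] at h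
      exact hA (hdet.symm.trans h.symm)
    obtain ⟨N, hN, hrank⟩ := exists_normalRank_add_mul_eq_succ hn hB (P₀ := Q₀) (P₁ := Q₁)
      (by omega)
    refine ⟨_, _, hrank.trans (by rw [hQ]), ?_⟩
    rw [← hdet]
    have h : ∀ A Q : Matrix (Fin n) (Fin n) F, A + (Q + (A + Q) * N) = (A + Q) * (1 + N) :=
      fun A Q => by rw [Matrix.mul_add, Matrix.mul_one, add_assoc]
    rw [h, h, homPencil_mul, Matrix.det_mul, ← RingHom.mapMatrix_apply, ← RingHom.map_det, hN,
      map_one, mul_one]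

/-- A common divisor of the minors taken from a fixed set of rows divides the determinant. -/
lemma dvd_det_of_dvd_det_submatrix {R ι : Type*} [CommRing R] [Fintype ι] [DecidableEq ι]
    (N : Matrix ι ι R) (d : R) {k : ℕ} (ri : Fin k → ι) (hri : Function.Injective ri)
    (h : ∀ ci : Fin k → ι, d ∣ (N.submatrix ri ci).det) : d ∣ N.det := by
  obtain ⟨j, hj⟩ : ∃ j, Fintype.card ι = k + j :=
    Nat.exists_eq_add_of_le (by simpa using Fintype.card_le_of_injective ri hri)
  induction j generalizing k with
  | zero =>
    let e := Equiv.ofBijective ri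
      ((Fintype.bijective_iff_injective_and_card ri).mpr ⟨hri, by simpa using hj.symm⟩)
    rw [← Matrix.det_submatrix_equiv_self e]
    exact h e
  | succ j ih =>
    obtain ⟨i, hi⟩ : ∃ i, i ∉ Set.range ri := by
      by_contra! hs
      have := Fintype.card_le_of_surjective ri hs
      rw [Fintype.card_fin] at this
      omega
    refine ih (Fin.cons i ri : Fin (k + 1) → ι) (Fin.cons_injective_iff.mpr ⟨hi, hri⟩)
      (fun ci => ?_) (by omega)
    rw [Matrix.det_succ_row_zero]
    refine Finset.dvd_sum fun l _ => Dvd.dvd.mul_left ?_ _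
    rw [Matrix.submatrix_submatrix]
    exact h _

lemma dvd_det_add_of_dvd_minors {R : Type*} [CommRing R] {k r : ℕ}
    (M Q : Matrix (Fin (k + r)) (Fin (k + r)) R) (d : R)
    (hM : ∀ ri ci : Fin k → Fin (k + r), d ∣ (M.submatrix ri ci).det)
    (hQ : ∀ ri ci : Fin (r + 1) → Fin (k + r), (Q.submatrix ri ci).det = 0) :
    d ∣ (M + Q).det := by
  have hrows : ∀ (s : Finset (Fin (k + r))) (l : ℕ), l ≤ s.card →
      ∃ ri : Fin l → Fin (k + r), Function.Injective ri ∧ ∀ i, ri i ∈ s := fun s l hl =>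
    ⟨fun i => s.equivFin.symm (Fin.castLE hl i), fun i j hij => by
      simpa using hij, fun i => Subtype.prop _⟩
  have h := (Matrix.detRowAlternating (R := R) (n := Fin (k + r))).toMultilinearMap.map_add_univ M Q
  change (M + Q).det = _ at h
  rw [h]
  refine Finset.dvd_sum fun s _ => ?_
  change d ∣ Matrix.det (s.piecewise M Q)
  by_cases hs : k ≤ s.card
  · obtain ⟨ri, hri, hmem⟩ := hrows s k hs
    refine dvd_det_of_dvd_det_submatrix _ d ri hri fun ci => ?_
    convert hM ri ci using 2
    ext1 i j
    exact congrFun (Finset.piecewise_eq_of_mem s M Q (hmem i)) (ci j)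
  · have hc := s.card_add_card_compl
    rw [Fintype.card_fin] at hc
    obtain ⟨ri, hri, hmem⟩ := hrows sᶜ (r + 1) (by omega)
    rw [zero_dvd_iff.mp (dvd_det_of_dvd_det_submatrix (s.piecewise M Q) 0 ri hri fun ci => ?_)]
    · exact dvd_zero d
    · rw [zero_dvd_iff, ← hQ ri ci]
      congr 1
      ext1 i j
      exact congrFun (Finset.piecewise_eq_of_notMem s M Q (Finset.mem_compl.mp (hmem i))) (ci j)

lemma det_submatrix_homPencil_eq_zero {F : Type*} [Field F] {m n : ℕ}
    {P₀ P₁ : Matrix (Fin n) (Fin n) F} (hP : normalRank (pencilOf P₀ P₁) < m)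
    (ri ci : Fin m → Fin n) : ((homPencil P₀ P₁).submatrix ri ci).det = 0 := by
  have h : ((pencilOf P₀ P₁).submatrix ri ci).det = 0 := by
    by_contra h0
    let a := algebraMap (Polynomial F) (RatFunc F)
    have h1 : (((pencilOf P₀ P₁).map a).submatrix ri ci).det ≠ 0 := by
      rw [Matrix.submatrix_map, ← RingHom.mapMatrix_apply, ← RingHom.map_det]
      exact (map_ne_zero_iff a (IsFractionRing.injective _ _)).mpr h0
    have h2 := Matrix.rank_of_det_ne_zero h1
    have h3 := Matrix.rank_submatrix_le ((pencilOf P₀ P₁).map a) ri ci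
    rw [h2, Fintype.card_fin] at h3
    exact absurd (h3.trans_lt hP) (lt_irrefl m)
  rw [← aeval_X_one_det_submatrix_homPencil] at h
  rw [← Polynomial.homogenize_eq_of_isHomogeneous
    (isHomogeneous_det_submatrix_homPencil P₀ P₁ ri ci) h, Polynomial.homogenize_zero]

lemma homPencil_add {F : Type*} [Field F] {m n : ℕ} (A₀ A₁ B₀ B₁ : Matrix (Fin m) (Fin n) F) :
    homPencil (A₀ + B₀) (A₁ + B₁) = homPencil A₀ A₁ + homPencil B₀ B₁ := by
  ext1 i j
  simp only [homPencil, Matrix.add_apply, Matrix.smul_apply, Matrix.map_apply, smul_eq_mul, map_add]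
  ring

lemma homOf_pencilOf {F : Type*} [Field F] {n : ℕ} (A₀ A₁ : Matrix (Fin n) (Fin n) F) :
    homOf (pencilOf A₀ A₁) = homPencil A₀ A₁ := by
  unfold homOf
  congr 1 <;> ext1 i j <;> simp [pencilOf]

lemma isPencil_pencilOf {F : Type*} [Field F] {m n : ℕ} (A₀ A₁ : Matrix (Fin m) (Fin n) F) :
    IsPencil (pencilOf A₀ A₁) := fun i j => by
  have h : pencilOf A₀ A₁ i j = Polynomial.C (A₁ i j) * Polynomial.X + Polynomial.C (A₀ i j) := by
    simp [pencilOf]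
    ring
  rw [h]
  exact Polynomial.degree_linear_le

lemma IsPencil.exists_eq_pencilOf {F : Type*} [Field F] {m n : ℕ}
    {P : Matrix (Fin m) (Fin n) (Polynomial F)} (hP : IsPencil P) :
    ∃ P₀ P₁, P = pencilOf P₀ P₁ := by
  refine ⟨P.map fun p => p.coeff 0, P.map fun p => p.coeff 1, ?_⟩
  ext1 i j
  rw [Polynomial.eq_X_add_C_of_degree_le_one (hP i j)]
  simp [pencilOf]
  ring

/-- Determinant (homogeneous) assignment under fixed rank perturbation:
for `n ≥ 2`, a regular pencil `A(s)` with homogeneous invariant factors `φ`, a nonzero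
homogeneous `Ψ(s,t)` of degree `n` monic in `s`, with `F ∪ {∞}` not contained in
`Λ(A(s)) ∪ Λ(Ψ)`, and `0 ≤ r ≤ n`: there is a pencil `P(s)` of normal rank exactly `r`
such that the determinant of the homogeneous pencil of `A(s) + P(s)` is `k Ψ(s,t)` for
some nonzero `k ∈ F` iff `φ₁ ⋯ φ_{n-r} ∣ Ψ`. -/
theorem stmt17 (F : Type*) [Field F] (n : ℕ) (hn : 2 ≤ n)
    (A₀ A₁ : Matrix (Fin n) (Fin n) F) (hA : (pencilOf A₀ A₁).det ≠ 0)
    (φ : ℕ → MvPolynomial (Fin 2) F)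
    (hφ : IsHomogeneousIF A₀ A₁ φ) (hφc : ∀ i, i + 1 < n → φ i ∣ φ (i + 1))
    (Ψ : MvPolynomial (Fin 2) F) (hΨ0 : Ψ ≠ 0) (hΨh : Ψ.IsHomogeneous n)
    (hΨm : MvPolynomial.coeff (Finsupp.single (0 : Fin 2) n) Ψ = 1)
    (hc : (∃ c : F, IsUnit (A₀ + c • A₁).det ∧ MvPolynomial.eval ![c, 1] Ψ ≠ 0) ∨
      (IsUnit A₁.det ∧ MvPolynomial.eval ![1, 0] Ψ ≠ 0))
    (r : ℕ) (hr : r ≤ n) :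
    (∃ P : Matrix (Fin n) (Fin n) (Polynomial F), IsPencil P ∧ normalRank P = r ∧
        ∃ k : F, k ≠ 0 ∧ (homOf (pencilOf A₀ A₁ + P)).det = MvPolynomial.C k * Ψ) ↔
      (∏ i ∈ Finset.range (n - r), φ i) ∣ Ψ := by
  obtain ⟨k, rfl⟩ : ∃ k, n = k + r := ⟨n - r, by omega⟩
  rw [Nat.add_sub_cancel]
  obtain ⟨hdvd, hgcd⟩ := hφ k (Nat.le_add_right k r)
  constructor
  · rintro ⟨P, hP, hrank, c, hc0, hdet⟩
    obtain ⟨P₀, P₁, rfl⟩ := hP.exists_eq_pencilOf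
    rw [← pencilOf_add, homOf_pencilOf, homPencil_add] at hdet
    have h := dvd_det_add_of_dvd_minors (homPencil A₀ A₁) (homPencil P₀ P₁)
      (∏ i ∈ Finset.range k, φ i) (fun ri ci => ?_)
      (det_submatrix_homPencil_eq_zero (by omega))
    · rw [hdet] at h
      exact (IsUnit.dvd_mul_left ((IsUnit.mk0 c hc0).map MvPolynomial.C)).mp h
    · by_cases hri : Function.Injective ri
      · by_cases hci : Function.Injective ci
        · exact hdvd _ ⟨ri, ci, hri, hci, rfl⟩
        · obtain ⟨i, j, hij, hne⟩ := Function.not_injective_iff.mp hci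
          rw [Matrix.det_zero_of_column_eq hne fun l => by simp [hij]]
          exact dvd_zero _
      · obtain ⟨i, j, hij, hne⟩ := Function.not_injective_iff.mp hri
        rw [Matrix.det_zero_of_row_eq hne (by ext1 l; simp [hij])]
        exact dvd_zero _
  · intro h
    obtain ⟨P₀, P₁, hP, c, hc0, hdet⟩ := exists_normalRank_le_det_homPencil_eq hΨh hc
      fun d hd => (hgcd d hd).trans h
    obtain ⟨Q₀, Q₁, hQ, hdet'⟩ := exists_normalRank_eq_det_homPencil_eq hn hr (hdet ▸
      mul_ne_zero (by simpa using hc0) hΨ0) hP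
    refine ⟨pencilOf Q₀ Q₁, isPencil_pencilOf _ _, hQ, c, hc0, ?_⟩
    rw [← pencilOf_add, homOf_pencilOf, hdet', hdet]
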